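/- Let a, b, c, d, x₀, x₁ be real numbers with a < 0, c < 0, b > 0, d > 0, x₀ > √3 and x₁ > √3. Then the piecewise holomorphic system ż = (a+ib)(z − i + x₁) for z ∈ Σ_+, ż = i z³ for z ∈ Σ_c, ż = (c+id)(z + i − x₀) for z ∈ Σ_−, has a crossing limit cycle. -/

import Mathlib

open Complex Set

/-- A *crossing periodic orbit* of the piecewise system `z' = fields σ z` for `z ∈ zones σ`,
where the discontinuity set is the union of the zero sets of the functions in `curves`:
a nonconstant continuous `T`-periodic curve, satisfying the differential equation of each
zone inside that (open) zone, meeting the discontinuity set at only finitely many times per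
period, and crossing it transversally there (at each such point the two one-sided vector
fields have nonzero normal component to the discontinuity curve, of the same sign; the normal
direction is given by the gradient, i.e. the Fréchet derivative, of the defining function of
the curve). -/
def IsCrossingPeriodicOrbit {ι : Type} (zones : ι → Set ℂ) (fields : ι → ℂ → ℂ)
    (curves : Set (ℂ → ℝ)) (z : ℝ → ℂ) : Prop :=
  ∃ T : ℝ, 0 < T ∧
    Continuous z ∧ Function.Periodic z T ∧ (∃ s t : ℝ, z s ≠ z t) ∧
    (∀ (t : ℝ) (σ : ι), z t ∈ zones σ → HasDerivAt z (fields σ (z t)) t) ∧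
    {t ∈ Set.Ico (0:ℝ) T | ∃ g ∈ curves, g (z t) = 0}.Finite ∧
    (∀ t : ℝ, (∃ g ∈ curves, g (z t) = 0) →
      ∃ σ₁ σ₂ : ι, σ₁ ≠ σ₂ ∧
        (∃ ε > 0, (∀ s ∈ Set.Ioo (t - ε) t, z s ∈ zones σ₁) ∧
                  (∀ s ∈ Set.Ioo t (t + ε), z s ∈ zones σ₂)) ∧
        (∀ g ∈ curves, g (z t) = 0 →
          fderiv ℝ g (z t) (fields σ₁ (z t)) ≠ 0 ∧
          fderiv ℝ g (z t) (fields σ₂ (z t)) ≠ 0 ∧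
          (0 < fderiv ℝ g (z t) (fields σ₁ (z t)) ↔
           0 < fderiv ℝ g (z t) (fields σ₂ (z t)))))

/-- A *crossing limit cycle*: a crossing periodic orbit whose image is isolated among
the images of crossing periodic orbits. -/
def IsCrossingLimitCycle {ι : Type} (zones : ι → Set ℂ) (fields : ι → ℂ → ℂ)
    (curves : Set (ℂ → ℝ)) (z : ℝ → ℂ) : Prop :=
  IsCrossingPeriodicOrbit zones fields curves z ∧
  ∃ U : Set ℂ, IsOpen U ∧ Set.range z ⊆ U ∧
    ∀ w : ℝ → ℂ, IsCrossingPeriodicOrbit zones fields curves w →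
      Set.range w ⊆ U → Set.range w = Set.range z

/-- The three zones separated by the parallel lines `Im z = 1` and `Im z = -1`:
`Σ₊ = {Im z > 1}`, `Σ_c = {|Im z| < 1}`, `Σ₋ = {Im z < -1}`. -/
def zonesLines : Fin 3 → Set ℂ :=
  ![{z : ℂ | 1 < z.im}, {z : ℂ | |z.im| < 1}, {z : ℂ | z.im < -1}]

/-- The discontinuity curves `Im z = 1` and `Im z = -1`, given by level functions. -/
def curvesLines : Set (ℂ → ℝ) :=
  {fun z => z.im - 1, fun z => z.im + 1}


lemma lc_right_deriv {f : ℂ → ℂ} (hf : Continuous f) {w : ℝ → ℂ} (hw : Continuous w) {x δ : ℝ}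
    (hδ : 0 < δ) (dw : ∀ s ∈ Ioo x (x + δ), HasDerivAt w (f (w s)) s) :
    HasDerivWithinAt w (f (w x)) (Ici x) x := by
  refine hasDerivWithinAt_Ici_of_tendsto_deriv (s := Ioo x (x + δ)) ?_ hw.continuousWithinAt
    (Ioo_mem_nhdsGT (by linarith)) ?_
  · intro s hs
    exact (dw s hs).differentiableAt.differentiableWithinAt
  · have h1 : Filter.Tendsto (fun s => f (w s)) (nhdsWithin x (Ioi x)) (nhds (f (w x))) :=
      ((hf.comp hw).tendsto x).mono_left nhdsWithin_le_nhds
    refine h1.congr' ?_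
    filter_upwards [Ioo_mem_nhdsGT (show x < x + δ by linarith)] with s hs
    exact (dw s hs).deriv.symm

lemma lc_local_unique {f : ℂ → ℂ} (hf : ContDiff ℝ 1 f) {w φ : ℝ → ℂ} (hw : Continuous w)
    (hφ : Continuous φ) {x δ : ℝ} (hδ : 0 < δ) (h : w x = φ x)
    (dw : ∀ s ∈ Ioo x (x + δ), HasDerivAt w (f (w s)) s)
    (dφ : ∀ s ∈ Ioo x (x + δ), HasDerivAt φ (f (φ s)) s) :
    ∃ η > 0, ∀ s ∈ Icc x (x + η), w s = φ s := by
  obtain ⟨K, S, hS, hL⟩ := (hf.contDiffAt (x := w x)).exists_lipschitzOnWith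
  have e1 : ∀ᶠ s in nhds x, w s ∈ S := hw.continuousAt.eventually hS
  have e2 : ∀ᶠ s in nhds x, φ s ∈ S := hφ.continuousAt.eventually (by rw [← h]; exact hS)
  obtain ⟨r, hr, hr'⟩ := Metric.eventually_nhds_iff.1 (e1.and e2)
  have hη : 0 < min (r / 2) (δ / 2) := by positivity
  have m1 := min_le_left (r / 2) (δ / 2)
  have m2 := min_le_right (r / 2) (δ / 2)
  refine ⟨min (r / 2) (δ / 2), hη, ?_⟩
  set η := min (r / 2) (δ / 2)
  have hS' : ∀ s ∈ Ico x (x + η), w s ∈ S ∧ φ s ∈ S := by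
    intro s hs
    apply hr'
    rw [Real.dist_eq, abs_lt]
    constructor <;> linarith [hs.1, hs.2]
  have rd : ∀ (u : ℝ → ℂ), Continuous u → (∀ s ∈ Ioo x (x + δ), HasDerivAt u (f (u s)) s) →
      ∀ s ∈ Ico x (x + η), HasDerivWithinAt u (f (u s)) (Ici s) s := by
    intro u hu du s hs
    rcases eq_or_lt_of_le hs.1 with h | h
    · subst h
      exact lc_right_deriv hf.continuous hu hδ du
    · exact (du s ⟨h, by linarith [hs.2]⟩).hasDerivWithinAt
  exact ODE_solution_unique_of_mem_Icc_right (v := fun _ => f) (s := fun _ => S) (K := K)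
    (fun t _ => hL) hw.continuousOn (rd w hw dw) (fun t ht => (hS' t ht).1)
    hφ.continuousOn (rd φ hφ dφ) (fun t ht => (hS' t ht).2) h

lemma lc_arc_unique {f : ℂ → ℂ} (hf : ContDiff ℝ 1 f) {Z : Set ℂ} (hZ : IsOpen Z)
    {w φ : ℝ → ℂ} (hw : Continuous w)
    (hφ : Continuous φ) {t τ ε : ℝ} (hε : 0 < ε) (h : w t = φ 0)
    (dw : ∀ s, w s ∈ Z → HasDerivAt w (f (w s)) s)
    (wZ : ∀ s ∈ Ioo t (t + ε), w s ∈ Z)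
    (dφ : ∀ s ∈ Ioo 0 τ, φ s ∈ Z ∧ HasDerivAt φ (f (φ s)) s) :
    ∀ s ∈ Icc 0 τ, w (t + s) = φ s := by
  have hw' : Continuous fun s => w (t + s) := by fun_prop
  have dw' : ∀ s, w (t + s) ∈ Z → HasDerivAt (fun s => w (t + s)) (f (w (t + s))) s := by
    intro s hs
    exact (dw _ hs).comp_const_add t s
  have key : Icc 0 τ ⊆ {s | w (t + s) = φ s} := by
    apply IsClosed.Icc_subset_of_forall_exists_gt
    · exact (isClosed_eq hw' hφ).inter isClosed_Icc
    · simpa using h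
    · rintro x ⟨hx, hx0, hxτ⟩ y hy
      simp only [mem_ofPred_eq, mem_Ioi] at hx hy
      have : ∃ δ > 0, ∀ s ∈ Ioo x (x + δ), w (t + s) ∈ Z := by
        rcases eq_or_lt_of_le hx0 with h0 | h0
        · subst h0
          exact ⟨ε, hε, fun s hs => wZ _ ⟨by linarith [hs.1], by linarith [hs.2]⟩⟩
        · have : w (t + x) ∈ Z := by rw [hx]; exact (dφ x ⟨h0, hxτ⟩).1
          have e : ∀ᶠ s in nhds x, w (t + s) ∈ Z :=
            hw'.continuousAt.eventually (hZ.mem_nhds this)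
          obtain ⟨r, hr, hr'⟩ := Metric.eventually_nhds_iff.1 e
          refine ⟨r, hr, fun s hs => hr' ?_⟩
          rw [Real.dist_eq, abs_lt]
          constructor <;> linarith [hs.1, hs.2]
      obtain ⟨δ, hδ, hδZ⟩ := this
      obtain ⟨η, hη, H⟩ := lc_local_unique (δ := min δ (τ - x)) hf hw' hφ
        (lt_min hδ (by linarith)) hx
        (fun s hs => dw' s (hδZ s ⟨hs.1, by linarith [hs.2, min_le_left δ (τ - x)]⟩))
        (fun s hs => (dφ s ⟨by linarith [hs.1], by linarith [hs.2, min_le_right δ (τ - x)]⟩).2)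
      have hm : 0 < min η (y - x) := lt_min hη (by linarith)
      refine ⟨x + min η (y - x), H _ ⟨by linarith, by linarith [min_le_left η (y - x)]⟩, ?_, ?_⟩
      · linarith
      · linarith [min_le_right η (y - x)]
  exact key

/-- the linear arc -/
noncomputable def lcL (a b p q : ℝ) (k : ℝ) (s : ℝ) : ℂ :=
  ((p : ℂ) + (k : ℂ) * I) + ((q - p : ℝ) : ℂ) * exp (((a : ℂ) + (b : ℂ) * I) * (s : ℂ))

lemma lcL_cont (a b p q k : ℝ) : Continuous (lcL a b p q k) := by
  unfold lcL; fun_prop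

lemma lcL_zero (a b p q k : ℝ) : lcL a b p q k 0 = (q : ℂ) + (k : ℂ) * I := by
  simp [lcL]; ring

lemma lcL_end (a b p q k : ℝ) (hb : 0 < b) : lcL a b p q k (Real.pi / b) =
    ((p - (q - p) * Real.exp (a * Real.pi / b) : ℝ) : ℂ) + (k : ℂ) * I := by
  have : ((a : ℂ) + (b : ℂ) * I) * ((Real.pi / b : ℝ) : ℂ) =
      ((a * Real.pi / b : ℝ) : ℂ) + Real.pi * I := by
    have : (b : ℂ) ≠ 0 := by exact_mod_cast hb.ne'
    push_cast; field_simp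
  rw [lcL, this, exp_add, exp_pi_mul_I, ← ofReal_exp]
  push_cast; ring

lemma lcL_im (a b p q k s : ℝ) : (lcL a b p q k s).im =
    k + (q - p) * (Real.exp (a * s) * Real.sin (b * s)) := by
  rw [lcL, add_im, im_ofReal_mul, exp_im]
  simp

lemma lcL_deriv (a b p q k s : ℝ) : HasDerivAt (lcL a b p q k)
    (((a : ℂ) + (b : ℂ) * I) * (lcL a b p q k s - ((p : ℂ) + (k : ℂ) * I))) s := by
  have h1 : HasDerivAt (fun s : ℝ => ((a : ℂ) + (b : ℂ) * I) * (s : ℂ)) ((a : ℂ) + (b : ℂ) * I) s := by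
    simpa using (ofRealCLM.hasDerivAt (x := s)).const_mul ((a : ℂ) + (b : ℂ) * I)
  have h2 := ((h1.cexp).const_mul ((q - p : ℝ) : ℂ)).const_add ((p : ℂ) + (k : ℂ) * I)
  refine h2.congr_deriv ?_
  rw [lcL]; ring

lemma lcL_pos (a b s : ℝ) (hb : 0 < b) (hs : s ∈ Ioo 0 (Real.pi / b)) :
    0 < Real.exp (a * s) * Real.sin (b * s) := by
  apply mul_pos (Real.exp_pos _)
  apply Real.sin_pos_of_pos_of_lt_pi (mul_pos hb hs.1)
  have := (lt_div_iff₀ hb).1 hs.2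
  linarith

noncomputable def lcW (x s : ℝ) : ℂ :=
  (((x ^ 2 - 1) / (x ^ 2 + 1) ^ 2 : ℝ) : ℂ) + ((2 * x / (x ^ 2 + 1) ^ 2 - 2 * s : ℝ) : ℂ) * I

/-- the cubic arc -/
noncomputable def lcC (x s : ℝ) : ℂ := exp (-(log (lcW x s)) / 2)

noncomputable def lcτ (x : ℝ) : ℝ := 2 * x / (x ^ 2 + 1) ^ 2

lemma lcW_re (x s : ℝ) : (lcW x s).re = (x ^ 2 - 1) / (x ^ 2 + 1) ^ 2 := by
  rw [lcW]; simp [-ofReal_div, -ofReal_mul, -ofReal_sub]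

lemma lcW_im (x s : ℝ) : (lcW x s).im = lcτ x - 2 * s := by
  rw [lcW, lcτ]; simp [-ofReal_div, -ofReal_mul, -ofReal_sub]

lemma lc_sq {x : ℝ} (hx : Real.sqrt 3 < x) : 3 < x ^ 2 ∧ 0 < x := by
  have h0 : 0 < x := lt_of_le_of_lt (Real.sqrt_nonneg 3) hx
  exact ⟨(Real.sqrt_lt' h0).1 hx, h0⟩

lemma lcW_re_pos {x : ℝ} (hx : Real.sqrt 3 < x) (s : ℝ) : 0 < (lcW x s).re := by
  rw [lcW_re]
  have := lc_sq hx
  apply div_pos (by linarith) (by positivity)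

lemma lcW_slit {x : ℝ} (hx : Real.sqrt 3 < x) (s : ℝ) : lcW x s ∈ slitPlane :=
  Or.inl (lcW_re_pos hx s)

lemma lcW_ne {x : ℝ} (hx : Real.sqrt 3 < x) (s : ℝ) : lcW x s ≠ 0 :=
  slitPlane_ne_zero (lcW_slit hx s)

lemma lcC_sq {x : ℝ} (hx : Real.sqrt 3 < x) (s : ℝ) : lcC x s ^ 2 = (lcW x s)⁻¹ := by
  rw [lcC, ← exp_nat_mul, ← exp_log (lcW_ne hx s), ← exp_neg, exp_log (lcW_ne hx s)]
  congr 1; push_cast; ring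

lemma lcC_deriv {x : ℝ} (hx : Real.sqrt 3 < x) (s : ℝ) :
    HasDerivAt (lcC x) (I * lcC x s ^ 3) s := by
  have h0 : HasDerivAt (fun s : ℝ => (2 * x / (x ^ 2 + 1) ^ 2 - 2 * s : ℝ)) (-2) s := by
    simpa using ((hasDerivAt_id s).const_mul 2).const_sub (2 * x / (x ^ 2 + 1) ^ 2)
  have h1 : HasDerivAt (lcW x) (-2 * I) s := by
    have := (h0.ofReal_comp.mul_const I).const_add (((x ^ 2 - 1) / (x ^ 2 + 1) ^ 2 : ℝ) : ℂ)
    exact this.congr_deriv (by push_cast; ring)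
  have h2 := ((h1.clog_real (lcW_slit hx s)).neg.div_const 2).cexp
  refine h2.congr_deriv ?_
  have : lcC x s ^ 3 = lcC x s * (lcW x s)⁻¹ := by rw [← lcC_sq hx]; ring
  rw [this, lcC, Pi.neg_apply]
  ring

lemma lcC_cont {x : ℝ} (hx : Real.sqrt 3 < x) : Continuous (lcC x) :=
  continuous_iff_continuousAt.2 fun s => (lcC_deriv hx s).continuousAt

lemma lcC_re_pos {x : ℝ} (hx : Real.sqrt 3 < x) (s : ℝ) : 0 < (lcC x s).re := by
  rw [lcC, exp_re]
  apply mul_pos (Real.exp_pos _)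
  have h := abs_arg_lt_pi_div_two_iff.2 (Or.inl (lcW_re_pos hx s))
  rw [abs_lt] at h
  have : (-(log (lcW x s)) / 2).im = - (lcW x s).arg / 2 := by
    rw [show (2 : ℂ) = ((2 : ℝ) : ℂ) by norm_num, div_ofReal_im, neg_im, log_im]
  rw [this]
  apply Real.cos_pos_of_mem_Ioo
  constructor <;> linarith [h.1, h.2]

lemma lc_sqrt_unique {z w : ℂ} (hz : 0 < z.re) (hw : 0 < w.re) (h : z ^ 2 = w ^ 2) : z = w := by
  rcases sq_eq_sq_iff_eq_or_eq_neg.1 h with h | h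
  · exact h
  · rw [h, neg_re] at hz; linarith

lemma lcC_zero {x : ℝ} (hx : Real.sqrt 3 < x) : lcC x 0 = (x : ℂ) + ((-1 : ℝ) : ℂ) * I := by
  have h := lc_sq hx
  apply lc_sqrt_unique (lcC_re_pos hx 0) (by simpa using h.2)
  rw [lcC_sq hx]
  apply inv_eq_of_mul_eq_one_right
  have : x ^ 2 + 1 ≠ 0 := by positivity
  apply Complex.ext
  · simp only [mul_re, lcW_re, lcW_im, lcτ, sq]; simp; field_simp; ring
  · simp only [mul_im, lcW_re, lcW_im, lcτ, sq]; simp; field_simp; ring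

lemma lcC_end {x : ℝ} (hx : Real.sqrt 3 < x) : lcC x (lcτ x) = (x : ℂ) + ((1 : ℝ) : ℂ) * I := by
  have h := lc_sq hx
  apply lc_sqrt_unique (lcC_re_pos hx _) (by simpa using h.2)
  rw [lcC_sq hx]
  apply inv_eq_of_mul_eq_one_right
  have : x ^ 2 + 1 ≠ 0 := by positivity
  apply Complex.ext
  · simp only [mul_re, lcW_re, lcW_im, lcτ, sq]; simp; field_simp; ring
  · simp only [mul_im, lcW_re, lcW_im, lcτ, sq]; simp; field_simp; ring

lemma lcτ_pos {x : ℝ} (hx : Real.sqrt 3 < x) : 0 < lcτ x := by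
  have h := (lc_sq hx).2
  unfold lcτ; positivity

lemma lcC_cone {x : ℝ} (hx : Real.sqrt 3 < x) {s : ℝ} (hs : s ∈ Icc 0 (lcτ x)) :
    Real.sqrt 3 * |(lcC x s).im| < (lcC x s).re := by
  have hu := lcC_re_pos hx s
  have h := lc_sq hx
  have hk := lcW_re_pos hx s
  have e : lcC x s ^ 2 * lcW x s = 1 := by
    rw [lcC_sq hx]; exact inv_mul_cancel₀ (lcW_ne hx s)
  have hm : |(lcW x s).im| ≤ lcτ x := by
    rw [lcW_im, abs_le]; constructor <;> linarith [hs.1, hs.2]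
  have hkx : (lcW x s).re * (2 * x) = (x ^ 2 - 1) * lcτ x := by
    rw [lcW_re, lcτ]; ring
  have hτ := lcτ_pos hx
  generalize lcC x s = z at *
  generalize lcW x s = W at *
  have e1 := congrArg re e
  have e2 := congrArg im e
  simp only [sq, mul_re, mul_im, one_re, one_im] at e1 e2
  set u := z.re
  set v := z.im
  set k := W.re
  set m := W.im
  have e3 : (u * u - v * v) * (k ^ 2 + m ^ 2) = k := by linear_combination k * e1 + m * e2
  have hp : 0 < u * u - v * v := by
    by_contra hn
    have : (u * u - v * v) * (k ^ 2 + m ^ 2) ≤ 0 :=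
      mul_nonpos_of_nonpos_of_nonneg (not_lt.1 hn) (by positivity)
    linarith
  have e4 : 2 * u * |v| * k = (u * u - v * v) * |m| := by
    have : 2 * u * v * k = - ((u * u - v * v) * m) := by linarith
    have := congrArg abs this
    rwa [abs_neg, abs_mul, abs_mul, abs_mul, abs_mul, abs_of_pos hp, abs_of_pos hk, abs_of_pos hu,
      abs_two] at this
  have e5 : 2 * u * |v| * k ≤ (u * u - v * v) * lcτ x := by
    rw [e4]; exact mul_le_mul_of_nonneg_left hm hp.le
  have e6 : u * |v| * (x ^ 2 - 1) ≤ (u * u - v * v) * x := by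
    have : (u * |v| * (x ^ 2 - 1)) * lcτ x ≤ ((u * u - v * v) * x) * lcτ x := by
      have := mul_le_mul_of_nonneg_right e5 h.2.le
      calc _ = 2 * u * |v| * k * x := by linear_combination (-u * |v|) * hkx
        _ ≤ _ := this
        _ = _ := by ring
    exact le_of_mul_le_mul_right this hτ
  have e7 : 0 ≤ (u - x * |v|) * (x * u + |v|) := by
    have : v * v = |v| * |v| := (abs_mul_abs_self v).symm
    rw [this] at e6
    nlinarith
  have hv := abs_nonneg v
  have e8 : x * |v| ≤ u := by
    have : 0 < x * u + |v| := by have := mul_pos h.2 hu; linarith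
    have := nonneg_of_mul_nonneg_left e7 this
    linarith
  rcases eq_or_lt_of_le hv with h0 | h0
  · rw [← h0]; simpa using hu
  · exact lt_of_lt_of_le (mul_lt_mul_of_pos_right hx h0) e8

lemma lc_cube_im (z : ℂ) : (I * z ^ 3).im = z.re * (z.re ^ 2 - 3 * z.im ^ 2) := by
  simp [pow_succ]; ring

lemma lc_cone_sq {z : ℂ} (h : Real.sqrt 3 * |z.im| < |z.re|) : 0 < z.re ^ 2 - 3 * z.im ^ 2 := by
  have h1 : 0 ≤ Real.sqrt 3 * |z.im| := by positivity
  have := pow_lt_pow_left₀ h h1 two_ne_zero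
  rw [mul_pow, sq_abs, sq_abs, Real.sq_sqrt (by norm_num)] at this
  linarith

lemma lcC_strip {x : ℝ} (hx : Real.sqrt 3 < x) {s : ℝ} (hs : s ∈ Ioo 0 (lcτ x)) :
    |(lcC x s).im| < 1 := by
  have hτ := lcτ_pos hx
  have hd : ∀ s, HasDerivAt (fun s => (lcC x s).im) (I * lcC x s ^ 3).im s := fun s =>
    imCLM.hasFDerivAt.comp_hasDerivAt s (lcC_deriv hx s)
  have hmono : StrictMonoOn (fun s => (lcC x s).im) (Icc 0 (lcτ x)) := by
    apply strictMonoOn_of_deriv_pos (convex_Icc _ _)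
    · exact (continuous_im.comp (lcC_cont hx)).continuousOn
    · intro t ht
      rw [interior_Icc] at ht
      rw [(hd t).deriv, lc_cube_im]
      have hu := lcC_re_pos hx t
      apply mul_pos hu
      apply lc_cone_sq
      rw [abs_of_pos hu]
      exact lcC_cone hx (Ioo_subset_Icc_self ht)
  have h1 := hmono (left_mem_Icc.2 hτ.le) (Ioo_subset_Icc_self hs) hs.1
  have h2 := hmono (Ioo_subset_Icc_self hs) (right_mem_Icc.2 hτ.le) hs.2
  simp only [lcC_zero hx, lcC_end hx] at h1 h2
  simp at h1 h2
  exact abs_lt.2 ⟨h1, h2⟩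

noncomputable def lcF (a b c d x0 x1 : ℝ) : Fin 3 → ℂ → ℂ :=
  ![fun w => ((a : ℂ) + (b : ℂ) * Complex.I) * (w - Complex.I + (x1 : ℂ)),
    fun w => Complex.I * w ^ 3,
    fun w => ((c : ℂ) + (d : ℂ) * Complex.I) * (w + Complex.I - (x0 : ℂ))]

lemma lcF_zero (a b c d x0 x1 : ℝ) : lcF a b c d x0 x1 0 =
    fun w => ((a : ℂ) + (b : ℂ) * Complex.I) * (w - Complex.I + (x1 : ℂ)) := rfl
lemma lcF_one (a b c d x0 x1 : ℝ) : lcF a b c d x0 x1 1 = fun w => Complex.I * w ^ 3 := rfl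
lemma lcF_two (a b c d x0 x1 : ℝ) : lcF a b c d x0 x1 2 =
    fun w => ((c : ℂ) + (d : ℂ) * Complex.I) * (w + Complex.I - (x0 : ℂ)) := rfl

lemma lcF_contDiff (a b c d x0 x1 : ℝ) (σ : Fin 3) : ContDiff ℝ 1 (lcF a b c d x0 x1 σ) := by
  fin_cases σ
  · change ContDiff ℝ 1 (lcF a b c d x0 x1 0); rw [lcF_zero]; fun_prop
  · change ContDiff ℝ 1 (lcF a b c d x0 x1 1); rw [lcF_one]; fun_prop
  · change ContDiff ℝ 1 (lcF a b c d x0 x1 2); rw [lcF_two]; fun_prop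

lemma lcZ_zero (z : ℂ) : z ∈ zonesLines 0 ↔ 1 < z.im := Iff.rfl
lemma lcZ_one (z : ℂ) : z ∈ zonesLines 1 ↔ |z.im| < 1 := Iff.rfl
lemma lcZ_two (z : ℂ) : z ∈ zonesLines 2 ↔ z.im < -1 := Iff.rfl

lemma lcZ_open (σ : Fin 3) : IsOpen (zonesLines σ) := by
  fin_cases σ
  · exact isOpen_lt continuous_const continuous_im
  · exact isOpen_lt (continuous_abs.comp continuous_im) continuous_const
  · exact isOpen_lt continuous_im continuous_const

lemma lc_fderiv_im (k : ℝ) (z v : ℂ) : fderiv ℝ (fun z : ℂ => z.im + k) z v = v.im := by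
  have : HasFDerivAt (fun z : ℂ => z.im + k) imCLM z := (imCLM.hasFDerivAt (x := z)).add_const k
  rw [this.fderiv]; rfl

lemma lc_fderiv_im' (k : ℝ) (z v : ℂ) : fderiv ℝ (fun z : ℂ => z.im - k) z v = v.im := by
  simpa [sub_eq_add_neg] using lc_fderiv_im (-k) z v

lemma lc_curves (z : ℂ) : (∃ g ∈ curvesLines, g z = 0) ↔ (z.im = 1 ∨ z.im = -1) := by
  simp only [curvesLines, mem_insert_iff, mem_singleton_iff, exists_eq_or_imp, exists_eq_left]
  constructor
  · rintro (h | h)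
    · left; linarith
    · right; linarith
  · rintro (h | h)
    · left; linarith
    · right; linarith

lemma lc_curves_normal (z u v : ℂ) (hu : u.im ≠ 0) (hv : v.im ≠ 0) (huv : 0 < u.im ↔ 0 < v.im) :
    ∀ g ∈ curvesLines, g z = 0 → fderiv ℝ g z u ≠ 0 ∧ fderiv ℝ g z v ≠ 0 ∧
      (0 < fderiv ℝ g z u ↔ 0 < fderiv ℝ g z v) := by
  rintro g (rfl | rfl) _
  · simp only [lc_fderiv_im']; exact ⟨hu, hv, huv⟩
  · simp only [lc_fderiv_im]; exact ⟨hu, hv, huv⟩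

lemma lc_curves_normal' (z u v : ℂ) (hz : z.im = 1 ∨ z.im = -1)
    (h : ∀ g ∈ curvesLines, g z = 0 → fderiv ℝ g z u ≠ 0 ∧ fderiv ℝ g z v ≠ 0 ∧
      (0 < fderiv ℝ g z u ↔ 0 < fderiv ℝ g z v)) :
    u.im ≠ 0 ∧ v.im ≠ 0 ∧ (0 < u.im ↔ 0 < v.im) := by
  rcases hz with hz | hz
  · have := h (fun z => z.im - 1) (Or.inl rfl) (by simp [hz])
    simpa only [lc_fderiv_im'] using this
  · have := h (fun z => z.im + 1) (Or.inr rfl) (by simp [hz])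
    simpa only [lc_fderiv_im] using this

lemma lc_right_sign {h : ℝ → ℝ} {t v : ℝ} (hd : HasDerivWithinAt h v (Ici t) t) (hv : 0 < v) :
    ∀ᶠ s in nhdsWithin t (Ioi t), h t < h s := by
  have h1 := (hasDerivWithinAt_iff_tendsto_slope' (s := Ioi t) (by simp)).1
    (hd.mono Ioi_subset_Ici_self)
  filter_upwards [h1.eventually (lt_mem_nhds hv), self_mem_nhdsWithin] with s hs hst
  rw [slope_def_field] at hs
  have hst' : 0 < s - t := sub_pos.2 hst
  have := (div_pos_iff_of_pos_right hst').1 hs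
  linarith

lemma lc_enter {a b c d x0 x1 : ℝ} {w : ℝ → ℂ}
    (hw : IsCrossingPeriodicOrbit zonesLines (lcF a b c d x0 x1) curvesLines w)
    {t k : ℝ} (hk : k = 1 ∨ k = -1) (hwt : (w t).im = k) :
    ∃ ε > 0, ∀ s ∈ Ioo t (t + ε), |(w s).im - k| < 1 ∧
      (0 < (I * (w t) ^ 3).im → k < (w s).im) ∧ ((I * (w t) ^ 3).im < 0 → (w s).im < k) := by
  obtain ⟨T, hT, hcont, hper, hne, hode, hfin, hcr⟩ := hw
  have hkt : (w t).im = 1 ∨ (w t).im = -1 := by rw [hwt]; exact hk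
  obtain ⟨σ₁, σ₂, hσ, ⟨ε, hε, hl, hr⟩, hg⟩ := hcr t ((lc_curves _).2 hkt)
  obtain ⟨n1, n2, n12⟩ := lc_curves_normal' _ _ _ hkt hg
  have hnear : ∀ᶠ s in nhds t, |(w s).im - k| < 1 := by
    have : Continuous fun s => |(w s).im - k| := by fun_prop
    apply this.continuousAt.eventually (gt_mem_nhds _)
    simp [hwt]
  obtain ⟨r, hr0, hr'⟩ := Metric.eventually_nhds_iff.1 hnear
  have hm : 0 < min ε r := lt_min hε hr0
  have m1 := min_le_left ε r
  have m2 := min_le_right ε r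
  have zl := hl (t - min ε r / 2) ⟨by linarith, by linarith⟩
  have zr := hr (t + min ε r / 2) ⟨by linarith, by linarith⟩
  have kl := @hr' (t - min ε r / 2) (by rw [Real.dist_eq, abs_lt]; constructor <;> linarith)
  have kr := @hr' (t + min ε r / 2) (by rw [Real.dist_eq, abs_lt]; constructor <;> linarith)
  have h1 : σ₁ = 1 ∨ σ₂ = 1 := by
    by_contra hcon
    push Not at hcon
    obtain ⟨c1, c2⟩ := hcon
    have : (σ₁ = 0 ∧ σ₂ = 2) ∨ (σ₁ = 2 ∧ σ₂ = 0) := by lia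
    rw [abs_lt] at kl kr
    rcases this with ⟨rfl, rfl⟩ | ⟨rfl, rfl⟩
    · rw [lcZ_zero] at zl; rw [lcZ_two] at zr
      rcases hk with rfl | rfl <;> linarith
    · rw [lcZ_zero] at zr; rw [lcZ_two] at zl
      rcases hk with rfl | rfl <;> linarith
  have hs : (0 < (I * (w t) ^ 3).im ↔ 0 < (lcF a b c d x0 x1 σ₂ (w t)).im) := by
    rcases h1 with rfl | rfl
    · exact n12
    · exact Iff.rfl
  have hd : HasDerivWithinAt (fun s => (w s).im) (lcF a b c d x0 x1 σ₂ (w t)).im (Ici t) t := by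
    have := lc_right_deriv (lcF_contDiff a b c d x0 x1 σ₂).continuous hcont hε
      (fun s hs => hode s σ₂ (hr s hs))
    exact imCLM.hasFDerivAt.comp_hasDerivWithinAt t this
  have key : ∀ᶠ s in nhdsWithin t (Ioi t),
      (0 < (I * (w t) ^ 3).im → k < (w s).im) ∧ ((I * (w t) ^ 3).im < 0 → (w s).im < k) := by
    rcases lt_or_gt_of_ne n2 with hn | hp
    · have hd' := hd.neg
      filter_upwards [lc_right_sign hd' (by linarith)] with s hs'
      simp only [Pi.neg_apply, hwt] at hs'
      exact ⟨fun h => absurd (hs.1 h) (by linarith), fun _ => by linarith⟩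
    · filter_upwards [lc_right_sign hd hp] with s hs'
      rw [hwt] at hs'
      exact ⟨fun _ => hs', fun h => absurd (hs.2 hp) (by linarith)⟩
  have key2 := (hnear.filter_mono (nhdsWithin_le_nhds (s := Ioi t))).and key
  obtain ⟨u, hu, hu'⟩ := mem_nhdsGT_iff_exists_Ioo_subset.1 key2
  refine ⟨u - t, sub_pos.2 hu, fun s hs => hu' ⟨hs.1, by linarith [hs.2]⟩⟩

lemma lc_pt_im (x k : ℝ) : ((x : ℂ) + (k : ℂ) * I).im = k := by simp
lemma lc_pt_re (x k : ℝ) : ((x : ℂ) + (k : ℂ) * I).re = x := by simp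

lemma lc_step1 {a b c d x0 x1 : ℝ} {w : ℝ → ℂ}
    (hw : IsCrossingPeriodicOrbit zonesLines (lcF a b c d x0 x1) curvesLines w)
    {t x : ℝ} (hx : Real.sqrt 3 < x) (h : w t = (x : ℂ) + ((-1 : ℝ) : ℂ) * I) :
    ∀ s ∈ Icc 0 (lcτ x), w (t + s) = lcC x s := by
  obtain ⟨ε, hε, H⟩ := lc_enter hw (t := t) (k := -1) (Or.inr rfl) (by rw [h, lc_pt_im])
  obtain ⟨T, hT, hcont, hper, hne, hode, hfin, hcr⟩ := hw
  have hx' := lc_sq hx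
  have hv : 0 < (I * (w t) ^ 3).im := by
    rw [h, lc_cube_im, lc_pt_im, lc_pt_re]; apply mul_pos hx'.2; linarith
  refine lc_arc_unique (lcF_contDiff a b c d x0 x1 1) (lcZ_open 1) hcont (lcC_cont hx) hε
    (by rw [h, lcC_zero hx]) (fun s hs => hode s 1 hs) ?_ ?_
  · intro s hs
    obtain ⟨h1, h2, -⟩ := H s hs
    have h2 := h2 hv
    rw [abs_lt] at h1
    rw [lcZ_one, abs_lt]
    constructor <;> linarith
  · intro s hs
    exact ⟨lcC_strip hx hs, lcC_deriv hx s⟩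

lemma lc_arc3 (a b c d x0 x1 : ℝ) {y : ℝ} (hy : Real.sqrt 3 < -y) (s : ℝ) :
    HasDerivAt (fun s => - lcC (-y) s) (lcF a b c d x0 x1 1 (- lcC (-y) s)) s := by
  refine (lcC_deriv hy s).neg.congr_deriv ?_
  rw [lcF_one]; ring

lemma lc_step3 {a b c d x0 x1 : ℝ} {w : ℝ → ℂ}
    (hw : IsCrossingPeriodicOrbit zonesLines (lcF a b c d x0 x1) curvesLines w)
    {t y : ℝ} (hy : Real.sqrt 3 < -y) (h : w t = (y : ℂ) + ((1 : ℝ) : ℂ) * I) :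
    ∀ s ∈ Icc 0 (lcτ (-y)), w (t + s) = - lcC (-y) s := by
  obtain ⟨ε, hε, H⟩ := lc_enter hw (t := t) (k := 1) (Or.inl rfl) (by rw [h, lc_pt_im])
  obtain ⟨T, hT, hcont, hper, hne, hode, hfin, hcr⟩ := hw
  have hx' := lc_sq hy
  have hv : (I * (w t) ^ 3).im < 0 := by
    rw [h, lc_cube_im, lc_pt_im, lc_pt_re]
    apply mul_neg_of_neg_of_pos <;> nlinarith
  refine lc_arc_unique (lcF_contDiff a b c d x0 x1 1) (lcZ_open 1) (φ := fun s => - lcC (-y) s) hcont (lcC_cont hy).neg hε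
    (by rw [h, lcC_zero hy]; push_cast; ring) (fun s hs => hode s 1 hs) ?_ ?_
  · intro s hs
    obtain ⟨h1, -, h2⟩ := H s hs
    have h2 := h2 hv
    rw [abs_lt] at h1
    rw [lcZ_one, abs_lt]
    constructor <;> linarith
  · intro s hs
    refine ⟨?_, lc_arc3 a b c d x0 x1 hy s⟩
    rw [lcZ_one, neg_im, abs_neg]
    exact lcC_strip hy hs

lemma lc_arc2 (a b c d x0 x1 x s : ℝ) :
    HasDerivAt (lcL a b (-x1) x 1) (lcF a b c d x0 x1 0 (lcL a b (-x1) x 1 s)) s := by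
  refine (lcL_deriv a b (-x1) x 1 s).congr_deriv ?_
  rw [lcF_zero]; push_cast; ring

lemma lc_arc4 (a b c d x0 x1 y s : ℝ) :
    HasDerivAt (lcL c d x0 y (-1)) (lcF a b c d x0 x1 2 (lcL c d x0 y (-1) s)) s := by
  refine (lcL_deriv c d x0 y (-1) s).congr_deriv ?_
  rw [lcF_two]; push_cast; ring

lemma lc_arc2_mem {a b x1 x s : ℝ} (hb : 0 < b) (hx : -x1 < x) (hs : s ∈ Ioo 0 (Real.pi / b)) :
    lcL a b (-x1) x 1 s ∈ zonesLines 0 := by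
  rw [lcZ_zero, lcL_im]
  have := mul_pos (show 0 < x - -x1 by linarith) (lcL_pos a b s hb hs)
  linarith

lemma lc_arc4_mem {c d x0 y s : ℝ} (hd : 0 < d) (hy : y < x0) (hs : s ∈ Ioo 0 (Real.pi / d)) :
    lcL c d x0 y (-1) s ∈ zonesLines 2 := by
  rw [lcZ_two, lcL_im]
  have := mul_pos (show 0 < x0 - y by linarith) (lcL_pos c d s hd hs)
  linarith

lemma lc_step2 {a b c d x0 x1 : ℝ} {w : ℝ → ℂ} (hb : 0 < b)
    (hw : IsCrossingPeriodicOrbit zonesLines (lcF a b c d x0 x1) curvesLines w)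
    {t x : ℝ} (hx : Real.sqrt 3 < x) (hx1 : -x1 < x) (h : w t = (x : ℂ) + ((1 : ℝ) : ℂ) * I) :
    ∀ s ∈ Icc 0 (Real.pi / b), w (t + s) = lcL a b (-x1) x 1 s := by
  obtain ⟨ε, hε, H⟩ := lc_enter hw (t := t) (k := 1) (Or.inl rfl) (by rw [h, lc_pt_im])
  obtain ⟨T, hT, hcont, hper, hne, hode, hfin, hcr⟩ := hw
  have hx' := lc_sq hx
  have hv : 0 < (I * (w t) ^ 3).im := by
    rw [h, lc_cube_im, lc_pt_im, lc_pt_re]; apply mul_pos hx'.2; linarith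
  refine lc_arc_unique (lcF_contDiff a b c d x0 x1 0) (lcZ_open 0) hcont (lcL_cont _ _ _ _ _) hε
    (by rw [h, lcL_zero]) (fun s hs => hode s 0 hs) ?_ ?_
  · intro s hs
    exact (H s hs).2.1 hv
  · intro s hs
    exact ⟨lc_arc2_mem hb hx1 hs, lc_arc2 a b c d x0 x1 x s⟩

lemma lc_step4 {a b c d x0 x1 : ℝ} {w : ℝ → ℂ} (hd : 0 < d)
    (hw : IsCrossingPeriodicOrbit zonesLines (lcF a b c d x0 x1) curvesLines w)
    {t y : ℝ} (hy : Real.sqrt 3 < -y) (hx0 : y < x0) (h : w t = (y : ℂ) + ((-1 : ℝ) : ℂ) * I) :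
    ∀ s ∈ Icc 0 (Real.pi / d), w (t + s) = lcL c d x0 y (-1) s := by
  obtain ⟨ε, hε, H⟩ := lc_enter hw (t := t) (k := -1) (Or.inr rfl) (by rw [h, lc_pt_im])
  obtain ⟨T, hT, hcont, hper, hne, hode, hfin, hcr⟩ := hw
  have hx' := lc_sq hy
  have hv : (I * (w t) ^ 3).im < 0 := by
    rw [h, lc_cube_im, lc_pt_im, lc_pt_re]
    apply mul_neg_of_neg_of_pos <;> nlinarith
  refine lc_arc_unique (lcF_contDiff a b c d x0 x1 2) (lcZ_open 2) hcont (lcL_cont _ _ _ _ _) hε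
    (by rw [h, lcL_zero]) (fun s hs => hode s 2 hs) ?_ ?_
  · intro s hs
    exact (H s hs).2.2 hv
  · intro s hs
    exact ⟨lc_arc4_mem hd hx0 hs, lc_arc4 a b c d x0 x1 y s⟩

def lcU : Set ℂ := {z | 1 < |z.im|} ∪ {z | Real.sqrt 3 * |z.im| < |z.re|}

lemma lcU_open : IsOpen lcU := by
  apply IsOpen.union
  · exact isOpen_lt continuous_const (by fun_prop)
  · exact isOpen_lt (by fun_prop) (by fun_prop)

lemma lcU_cone {z : ℂ} (hz : z ∈ lcU) (h : |z.im| ≤ 1) : Real.sqrt 3 * |z.im| < |z.re| := by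
  rcases hz with hz | hz
  · have : 1 < |z.im| := hz
    linarith
  · exact hz

lemma lc_N_deriv {w : ℝ → ℂ} {a b p k t : ℝ}
    (h : HasDerivAt w (((a : ℂ) + (b : ℂ) * I) * (w t - ((p : ℂ) + (k : ℂ) * I))) t) :
    HasDerivAt (fun s => ((w s).re - p) ^ 2 + ((w s).im - k) ^ 2)
      (2 * a * (((w t).re - p) ^ 2 + ((w t).im - k) ^ 2)) t := by
  have h1 : HasDerivAt (fun s => (w s).re) _ t := reCLM.hasFDerivAt.comp_hasDerivAt t h
  have h2 : HasDerivAt (fun s => (w s).im) _ t := imCLM.hasFDerivAt.comp_hasDerivAt t h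
  refine (((h1.sub_const p).pow 2).add ((h2.sub_const k).pow 2)).congr_deriv ?_
  simp
  ring

lemma lc_hit {a b c d x0 x1 : ℝ} {w : ℝ → ℂ} (ha : a < 0) (hc : c < 0)
    (hw : IsCrossingPeriodicOrbit zonesLines (lcF a b c d x0 x1) curvesLines w)
    (hU : range w ⊆ lcU) : ∃ t, (w t).im = 1 ∨ (w t).im = -1 := by
  obtain ⟨T, hT, hcont, hper, hne, hode, hfin, hcr⟩ := hw
  by_contra hcon
  push Not at hcon
  have hc' : Continuous fun s => (w s).im := by fun_prop
  have ivt : ∀ k, (∀ t, (w t).im ≠ k) → ∀ s t, (w s).im < k → (w t).im < k := by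
    intro k hk s t hs
    by_contra hn
    obtain ⟨r, hr⟩ := mem_range_of_exists_le_of_exists_ge hc' ⟨s, hs.le⟩ ⟨t, not_lt.1 hn⟩
    exact hk r hr
  have i1 := ivt 1 (fun t => (hcon t).1)
  have i2 := ivt (-1) (fun t => (hcon t).2)
  have w0 : w 0 = w T := by have := hper 0; rw [zero_add] at this; exact this.symm
  rcases lt_or_gt_of_ne (hcon 0).1 with h1 | h1
  · rcases lt_or_gt_of_ne (hcon 0).2 with h2 | h2
    · have hz : ∀ t, (w t).im < -1 := fun t => i2 0 t h2
      have hD : ∀ t, HasDerivAt (fun s => ((w s).re - x0) ^ 2 + ((w s).im - -1) ^ 2)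
          (2 * c * (((w t).re - x0) ^ 2 + ((w t).im - -1) ^ 2)) t := fun t => by
        apply lc_N_deriv (b := d)
        refine (hode t 2 (hz t)).congr_deriv ?_
        rw [lcF_two]; push_cast; ring
      obtain ⟨r, -, hr⟩ := exists_hasDerivAt_eq_zero hT
        (fun t _ => (hD t).continuousAt.continuousWithinAt) (by simp only [w0]) (fun t _ => hD t)
      have := hz r
      have h3 : 0 < ((w r).re - x0) ^ 2 + ((w r).im - -1) ^ 2 := by nlinarith [sq_nonneg ((w r).re - x0)]
      nlinarith
    · have hz : ∀ t, |(w t).im| < 1 := fun t => by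
        rw [abs_lt]
        refine ⟨?_, i1 0 t h1⟩
        rcases lt_or_gt_of_ne (hcon t).2 with h | h
        · linarith [i2 t 0 h]
        · exact h
      have hD : ∀ t, HasDerivAt (fun s => (w s).im) (I * (w t) ^ 3).im t := fun t =>
        imCLM.hasFDerivAt.comp_hasDerivAt t (hode t 1 (hz t))
      obtain ⟨r, -, hr⟩ := exists_hasDerivAt_eq_zero hT
        hc'.continuousOn (by simp only [w0]) (fun t _ => hD t)
      have hcone := lcU_cone (hU ⟨r, rfl⟩) (hz r).le
      have h3 := lc_cone_sq hcone
      rw [lc_cube_im] at hr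
      rcases mul_eq_zero.1 hr with h | h
      · rw [h] at h3; nlinarith [sq_nonneg (w r).im]
      · linarith
  · have hz : ∀ t, 1 < (w t).im := fun t => by
      rcases lt_or_gt_of_ne (hcon t).1 with h | h
      · linarith [i1 t 0 h]
      · exact h
    have hD : ∀ t, HasDerivAt (fun s => ((w s).re - (-x1)) ^ 2 + ((w s).im - 1) ^ 2)
        (2 * a * (((w t).re - (-x1)) ^ 2 + ((w t).im - 1) ^ 2)) t := fun t => by
      apply lc_N_deriv (b := b)
      refine (hode t 0 (hz t)).congr_deriv ?_
      rw [lcF_zero]; push_cast; ring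
    obtain ⟨r, -, hr⟩ := exists_hasDerivAt_eq_zero hT
      (fun t _ => (hD t).continuousAt.continuousWithinAt) (by simp only [w0]) (fun t _ => hD t)
    have := hz r
    have h3 : 0 < ((w r).re - (-x1)) ^ 2 + ((w r).im - 1) ^ 2 := by
      nlinarith [sq_nonneg ((w r).re - (-x1))]
    nlinarith

noncomputable def lcCat (φ ψ : ℝ → ℂ) (τ : ℝ) (s : ℝ) : ℂ := if s ≤ τ then φ s else ψ (s - τ)

lemma lcCat_cont {φ ψ : ℝ → ℂ} {τ : ℝ} (hφ : Continuous φ) (hψ : Continuous ψ) (h : φ τ = ψ 0) :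
    Continuous (lcCat φ ψ τ) := by
  unfold lcCat
  refine Continuous.if_le hφ (by fun_prop) continuous_id continuous_const ?_
  intro s hs
  rw [hs, h, sub_self]

lemma lcCat_left {φ ψ : ℝ → ℂ} {τ s : ℝ} (hs : s ≤ τ) : lcCat φ ψ τ s = φ s := if_pos hs

lemma lcCat_right {φ ψ : ℝ → ℂ} {τ s : ℝ} (h : φ τ = ψ 0) (hs : 0 ≤ s) :
    lcCat φ ψ τ (τ + s) = ψ s := by
  unfold lcCat
  split_ifs with h1
  · have : s = 0 := by linarith
    rw [this, add_zero, h]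
  · rw [add_sub_cancel_left]

lemma lcCat_follow {w φ ψ : ℝ → ℂ} {t τ τ' : ℝ} (h1 : ∀ s ∈ Icc 0 τ, w (t + s) = φ s)
    (h2 : ∀ s ∈ Icc 0 τ', w (t + τ + s) = ψ s) :
    ∀ s ∈ Icc 0 (τ + τ'), w (t + s) = lcCat φ ψ τ s := by
  intro s hs
  unfold lcCat
  split_ifs with h
  · exact h1 s ⟨hs.1, h⟩
  · rw [← h2 (s - τ) ⟨by linarith, by linarith [hs.2]⟩]
    congr 1; ring

noncomputable def lcY (a b x1 x : ℝ) : ℝ := -x1 - (x - -x1) * Real.exp (a * Real.pi / b)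

noncomputable def lcP (a b c d x0 x1 x : ℝ) : ℝ :=
  x0 - (lcY a b x1 x - x0) * Real.exp (c * Real.pi / d)

noncomputable def lcG (a b c d x0 x1 x : ℝ) : ℝ → ℂ :=
  lcCat (lcC x) (lcCat (lcL a b (-x1) x 1) (lcCat (fun s => - lcC (-(lcY a b x1 x)) s)
    (lcL c d x0 (lcY a b x1 x) (-1)) (lcτ (-(lcY a b x1 x)))) (Real.pi / b)) (lcτ x)

noncomputable def lcT (a b d x1 x : ℝ) : ℝ :=
  lcτ x + (Real.pi / b + (lcτ (-(lcY a b x1 x)) + Real.pi / d))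

section
variable {a b c d x0 x1 x : ℝ}

lemma lcY_lt (hx1 : Real.sqrt 3 < x1) (hx : Real.sqrt 3 < x) : lcY a b x1 x < -x1 := by
  unfold lcY
  have h0 := (lc_sq hx1).2
  have h1 := (lc_sq hx).2
  have := mul_pos (show 0 < x - -x1 by linarith) (Real.exp_pos (a * Real.pi / b))
  linarith

lemma lcY_neg (hx1 : Real.sqrt 3 < x1) (hx : Real.sqrt 3 < x) :
    Real.sqrt 3 < -(lcY a b x1 x) := by
  linarith [lcY_lt (a := a) (b := b) hx1 hx]

lemma lcP_gt (hx0 : Real.sqrt 3 < x0) {y : ℝ} (hy : Real.sqrt 3 < -y) :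
    x0 < x0 - (y - x0) * Real.exp (c * Real.pi / d) := by
  have h0 := (lc_sq hx0).2
  have h1 := (lc_sq hy).2
  have := mul_pos (show 0 < x0 - y by linarith) (Real.exp_pos (c * Real.pi / d))
  linarith

lemma lc_m1 (hx : Real.sqrt 3 < x) : lcC x (lcτ x) = lcL a b (-x1) x 1 0 := by
  rw [lcC_end hx, lcL_zero]

lemma lc_m2 (hb : 0 < b) (hy : Real.sqrt 3 < -(lcY a b x1 x)) :
    lcL a b (-x1) x 1 (Real.pi / b) = (fun s => - lcC (-(lcY a b x1 x)) s) 0 := by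
  simp only [lcC_zero hy]
  rw [lcL_end _ _ _ _ _ hb, ← lcY]; push_cast; ring

lemma lc_m3 {y : ℝ} (hy : Real.sqrt 3 < -y) :
    (fun s => - lcC (-y) s) (lcτ (-y)) = lcL c d x0 y (-1) 0 := by
  simp only [lcC_end hy]
  rw [lcL_zero]; push_cast; ring

lemma lcG_end (hx : Real.sqrt 3 < x) (hx1 : Real.sqrt 3 < x1) (hb : 0 < b) (hd : 0 < d) :
    lcG a b c d x0 x1 x (lcT a b d x1 x) =
      ((lcP a b c d x0 x1 x : ℝ) : ℂ) + ((-1 : ℝ) : ℂ) * I := by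
  have hy := lcY_neg (a := a) (b := b) hx1 hx
  have hπ := Real.pi_pos
  have p1 : 0 < Real.pi / b := by positivity
  have p2 : 0 < Real.pi / d := by positivity
  have p3 := lcτ_pos hy
  unfold lcG lcT
  rw [lcCat_right, lcCat_right, lcCat_right, lcL_end _ _ _ _ _ hd, ← lcP]
  · exact lc_m3 hy
  · exact p2.le
  · rw [lcCat_left p3.le]; exact lc_m2 hb hy
  · positivity
  · rw [lcCat_left p1.le]; exact lc_m1 hx
  · positivity

lemma lcG_cont (hx : Real.sqrt 3 < x) (hx1 : Real.sqrt 3 < x1) (hb : 0 < b) :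
    Continuous (lcG a b c d x0 x1 x) := by
  have hy := lcY_neg (a := a) (b := b) hx1 hx
  have hπ := Real.pi_pos
  have p1 : 0 < Real.pi / b := by positivity
  have p3 := lcτ_pos hy
  unfold lcG
  refine lcCat_cont (lcC_cont hx) (lcCat_cont (lcL_cont _ _ _ _ _) (lcCat_cont (lcC_cont hy).neg
    (lcL_cont _ _ _ _ _) ?_) ?_) ?_
  · exact lc_m3 hy
  · rw [lcCat_left p3.le]; exact lc_m2 hb hy
  · rw [lcCat_left p1.le]; exact lc_m1 hx

lemma lcT_pos (hx : Real.sqrt 3 < x) (hx1 : Real.sqrt 3 < x1) (hb : 0 < b) (hd : 0 < d) :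
    0 < lcT a b d x1 x := by
  have p3 := lcτ_pos (lcY_neg (a := a) (b := b) hx1 hx)
  have p4 := lcτ_pos hx
  have hπ := Real.pi_pos
  unfold lcT
  positivity

lemma lc_cycle {w : ℝ → ℂ} (hb : 0 < b) (hd : 0 < d) (hx0 : Real.sqrt 3 < x0)
    (hx1 : Real.sqrt 3 < x1)
    (hw : IsCrossingPeriodicOrbit zonesLines (lcF a b c d x0 x1) curvesLines w)
    {t : ℝ} (hx : Real.sqrt 3 < x) (h : w t = (x : ℂ) + ((-1 : ℝ) : ℂ) * I) :
    ∀ s ∈ Icc 0 (lcT a b d x1 x), w (t + s) = lcG a b c d x0 x1 x s := by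
  have hy := lcY_neg (a := a) (b := b) hx1 hx
  have hπ := Real.pi_pos
  have p1 : 0 < Real.pi / b := by positivity
  have p3 := lcτ_pos hy
  have p4 := lcτ_pos hx
  have s0 := (lc_sq hx0).2
  have s1 := (lc_sq hx1).2
  have s2 := (lc_sq hx).2
  have s3 := (lc_sq hy).2
  have f1 := lc_step1 hw hx h
  have e1 := f1 _ (right_mem_Icc.2 p4.le)
  rw [lcC_end hx] at e1
  have f2 := lc_step2 hb hw hx (by linarith) e1
  have e2 := f2 _ (right_mem_Icc.2 p1.le)
  rw [lcL_end _ _ _ _ _ hb, ← lcY] at e2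
  have f3 := lc_step3 hw hy e2
  have e3 := f3 _ (right_mem_Icc.2 p3.le)
  rw [lcC_end hy] at e3
  have f4 := lc_step4 hd hw hy (by linarith) (e3.trans (by push_cast; ring))
  exact lcCat_follow f1 (lcCat_follow f2 (lcCat_follow f3 f4))

/-- every orbit in `lcU` hits the lower line on the right -/
lemma lc_hit_right {w : ℝ → ℂ} (ha : a < 0) (hc : c < 0) (hb : 0 < b) (hd : 0 < d)
    (hx0 : Real.sqrt 3 < x0) (hx1 : Real.sqrt 3 < x1)
    (hw : IsCrossingPeriodicOrbit zonesLines (lcF a b c d x0 x1) curvesLines w)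
    (hU : range w ⊆ lcU) :
    ∃ t x : ℝ, Real.sqrt 3 < x ∧ w t = (x : ℂ) + ((-1 : ℝ) : ℂ) * I := by
  have hπ := Real.pi_pos
  have p1 : 0 < Real.pi / b := by positivity
  have p2 : 0 < Real.pi / d := by positivity
  have s0 := (lc_sq hx0).2
  have s1 := (lc_sq hx1).2
  have c3 : ∀ t y : ℝ, Real.sqrt 3 < -y → w t = (y : ℂ) + ((-1 : ℝ) : ℂ) * I →
      ∃ t x : ℝ, Real.sqrt 3 < x ∧ w t = (x : ℂ) + ((-1 : ℝ) : ℂ) * I := by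
    intro t y hy h
    have s3 := (lc_sq hy).2
    have := lc_step4 hd hw hy (by linarith) h _ (right_mem_Icc.2 p2.le)
    rw [lcL_end _ _ _ _ _ hd] at this
    exact ⟨_, _, by linarith [lcP_gt (c := c) (d := d) hx0 hy], this⟩
  have c2 : ∀ t y : ℝ, Real.sqrt 3 < -y → w t = (y : ℂ) + ((1 : ℝ) : ℂ) * I →
      ∃ t x : ℝ, Real.sqrt 3 < x ∧ w t = (x : ℂ) + ((-1 : ℝ) : ℂ) * I := by
    intro t y hy h
    have := lc_step3 hw hy h _ (right_mem_Icc.2 (lcτ_pos hy).le)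
    rw [lcC_end hy] at this
    exact c3 _ y hy (this.trans (by push_cast; ring))
  have c1 : ∀ t x : ℝ, Real.sqrt 3 < x → w t = (x : ℂ) + ((1 : ℝ) : ℂ) * I →
      ∃ t x : ℝ, Real.sqrt 3 < x ∧ w t = (x : ℂ) + ((-1 : ℝ) : ℂ) * I := by
    intro t x hx h
    have s3 := (lc_sq hx).2
    have := lc_step2 hb hw hx (by linarith) h _ (right_mem_Icc.2 p1.le)
    rw [lcL_end _ _ _ _ _ hb, ← lcY] at this
    exact c2 _ _ (lcY_neg hx1 hx) this
  obtain ⟨t, ht⟩ := lc_hit ha hc hw hU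
  have hab : |(w t).im| = 1 := by rcases ht with h | h <;> simp [h]
  have hcone := lcU_cone (hU ⟨t, rfl⟩) hab.le
  rw [hab, mul_one, lt_abs] at hcone
  rcases ht with h | h
  · have e : w t = ((w t).re : ℂ) + ((1 : ℝ) : ℂ) * I := by rw [← h, re_add_im]
    rcases hcone with hc | hc
    · exact c1 _ _ hc e
    · exact c2 _ _ hc e
  · have e : w t = ((w t).re : ℂ) + ((-1 : ℝ) : ℂ) * I := by rw [← h, re_add_im]
    rcases hcone with hc | hc
    · exact ⟨_, _, hc, e⟩
    · exact c3 _ _ hc e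

lemma lcP_sub (x y : ℝ) : lcP a b c d x0 x1 x - lcP a b c d x0 x1 y =
    (Real.exp (a * Real.pi / b) * Real.exp (c * Real.pi / d)) * (x - y) := by
  unfold lcP lcY; ring

lemma lc_rate {a b : ℝ} (ha : a < 0) (hb : 0 < b) : Real.exp (a * Real.pi / b) < 1 := by
  rw [Real.exp_lt_one_iff]
  exact div_neg_of_neg_of_pos (mul_neg_of_neg_of_pos ha Real.pi_pos) hb

lemma lcP_gt' (hx0 : Real.sqrt 3 < x0) (hx1 : Real.sqrt 3 < x1) (hx : Real.sqrt 3 < x) :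
    x0 < lcP a b c d x0 x1 x := lcP_gt hx0 (lcY_neg hx1 hx)

lemma lc_isol {w : ℝ → ℂ} (ha : a < 0) (hc : c < 0) (hb : 0 < b) (hd : 0 < d)
    (hx0 : Real.sqrt 3 < x0) (hx1 : Real.sqrt 3 < x1)
    (hw : IsCrossingPeriodicOrbit zonesLines (lcF a b c d x0 x1) curvesLines w)
    (hU : range w ⊆ lcU) {X : ℝ} (hX : lcP a b c d x0 x1 X = X) :
    ∃ t, w t = (X : ℂ) + ((-1 : ℝ) : ℂ) * I := by
  obtain ⟨t, x, hx, h⟩ := lc_hit_right ha hc hb hd hx0 hx1 hw hU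
  suffices x = X by subst this; exact ⟨t, h⟩
  set P := lcP a b c d x0 x1
  have hgt : ∀ n : ℕ, Real.sqrt 3 < P^[n] x := by
    intro n
    induction n with
    | zero => exact hx
    | succ n ih => rw [Function.iterate_succ_apply']; exact hx0.trans (lcP_gt' hx0 hx1 ih)
  have hseq : ∀ n : ℕ, ∃ t, w t = ((P^[n] x : ℝ) : ℂ) + ((-1 : ℝ) : ℂ) * I := by
    intro n
    induction n with
    | zero => exact ⟨t, h⟩
    | succ n ih =>
      obtain ⟨t, ht⟩ := ih
      have := lc_cycle hb hd hx0 hx1 hw (hgt n) ht _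
        (right_mem_Icc.2 (lcT_pos (hgt n) hx1 hb hd).le)
      rw [lcG_end (hgt n) hx1 hb hd] at this
      rw [Function.iterate_succ_apply']
      exact ⟨_, this⟩
  have hform : ∀ n : ℕ, P^[n] x - X =
      (Real.exp (a * Real.pi / b) * Real.exp (c * Real.pi / d)) ^ n * (x - X) := by
    intro n
    induction n with
    | zero => simp
    | succ n ih =>
      rw [Function.iterate_succ_apply']
      nth_rewrite 1 [← hX]
      rw [lcP_sub, ih]; ring
  obtain ⟨T, hT, hcont, hper, hne, hode, hfin, hcr⟩ := hw
  have hS := hfin.image (fun t => (w t).re)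
  have hmem : ∀ n : ℕ, P^[n] x ∈ (fun t => (w t).re) ''
      {t ∈ Set.Ico (0:ℝ) T | ∃ g ∈ curvesLines, g (w t) = 0} := by
    intro n
    obtain ⟨t, ht⟩ := hseq n
    obtain ⟨s, hs, hst⟩ := hper.exists_mem_Ico₀ hT t
    rw [hst] at ht
    refine ⟨s, ⟨hs, (lc_curves _).2 (Or.inr (by rw [ht, lc_pt_im]))⟩, ?_⟩
    simp only [ht, lc_pt_re]
  have hninj : ¬ Function.Injective (fun n : ℕ => P^[n] x) := by
    intro hinj
    exact Set.infinite_range_of_injective hinj (hS.subset (range_subset_iff.2 hmem))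
  by_contra hne'
  apply hninj
  intro m n hmn
  simp only at hmn
  have e := hform m
  rw [hmn, hform n] at e
  have e := mul_right_cancel₀ (sub_ne_zero.2 hne') e
  have r1 := lc_rate ha hb
  have r2 := lc_rate hc hd
  have q1 := Real.exp_pos (a * Real.pi / b)
  have q2 := Real.exp_pos (c * Real.pi / d)
  exact ((pow_right_injective₀ (mul_pos q1 q2) (by nlinarith)) e).symm

lemma lc_range_eq {w z : ℝ → ℂ} (hb : 0 < b) (hd : 0 < d)
    (hx0 : Real.sqrt 3 < x0) (hx1 : Real.sqrt 3 < x1)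
    (hw : IsCrossingPeriodicOrbit zonesLines (lcF a b c d x0 x1) curvesLines w)
    {X t : ℝ} (hX : lcP a b c d x0 x1 X = X) (hX3 : Real.sqrt 3 < X)
    (ht : w t = (X : ℂ) + ((-1 : ℝ) : ℂ) * I)
    (hz : Function.Periodic z (lcT a b d x1 X))
    (hzG : ∀ s ∈ Icc 0 (lcT a b d x1 X), z s = lcG a b c d x0 x1 X s) :
    range w = range z := by
  set T := lcT a b d x1 X with hTdef
  have hT : 0 < T := lcT_pos hX3 hx1 hb hd
  have hn : ∀ n : ℕ, w (t + n * T) = (X : ℂ) + ((-1 : ℝ) : ℂ) * I := by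
    intro n
    induction n with
    | zero => simpa using ht
    | succ n ih =>
      have := lc_cycle hb hd hx0 hx1 hw hX3 ih _ (right_mem_Icc.2 hT.le)
      rw [lcG_end hX3 hx1 hb hd, hX] at this
      rw [← this]; congr 1; push_cast; ring
  have hrep : ∀ (n : ℕ), ∀ r ∈ Icc 0 T, w (t + n * T + r) = z r := by
    intro n r hr
    rw [hzG r hr]
    exact lc_cycle hb hd hx0 hx1 hw hX3 (hn n) r hr
  apply Subset.antisymm
  · rintro _ ⟨u, rfl⟩
    obtain ⟨T', hT', hcont, hper, -⟩ := hw
    obtain ⟨N, hN⟩ := exists_nat_gt ((t - u) / T')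
    have hN' : t - u < N * T' := (div_lt_iff₀ hT').1 hN
    have e : w u = w (u + N * T') := ((hper.nat_mul N) u).symm
    rw [e]
    set v := u + N * T' - t with hv
    have hv0 : 0 ≤ v := by linarith
    have f1 := Nat.floor_le (div_nonneg hv0 hT.le)
    have f2 := Nat.lt_floor_add_one (v / T)
    rw [le_div_iff₀ hT] at f1
    rw [div_lt_iff₀ hT] at f2
    have := hrep ⌊v / T⌋₊ (v - ⌊v / T⌋₊ * T) ⟨by linarith, by linarith⟩
    refine ⟨v - ⌊v / T⌋₊ * T, ?_⟩
    rw [← this]; congr 1; rw [hv]; ring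
  · rintro _ ⟨u, rfl⟩
    obtain ⟨s, hs, hst⟩ := hz.exists_mem_Ico₀ hT u
    rw [hst]
    exact ⟨_, hrep 0 s ⟨hs.1, hs.2.le⟩⟩

end

lemma lc_periodize {g : ℝ → ℂ} {T : ℝ} (hT : 0 < T) (hg : Continuous g) (h : g 0 = g T) :
    ∃ z : ℝ → ℂ, Continuous z ∧ Function.Periodic z T ∧ ∀ s ∈ Icc 0 T, z s = g s := by
  have : Fact (0 < T) := ⟨hT⟩
  have hper : Function.Periodic (fun t : ℝ => AddCircle.liftIco T 0 g (t : AddCircle T)) T := by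
    intro t
    simp only [AddCircle.coe_add, AddCircle.coe_period, add_zero]
  refine ⟨fun t => AddCircle.liftIco T 0 g (t : AddCircle T), ?_, hper, ?_⟩
  · exact (AddCircle.liftIco_zero_continuous h hg.continuousOn).comp
      (AddCircle.continuous_mk' T)
  · intro s hs
    rcases eq_or_lt_of_le hs.2 with h1 | h1
    · have := hper 0
      simp only [zero_add] at this
      subst h1
      simp only
      rw [this, AddCircle.liftIco_zero_coe_apply ⟨le_rfl, hT⟩, h]
    · exact AddCircle.liftIco_zero_coe_apply ⟨hs.1, h1⟩

/-- on the open time interval `(t, t + τ)` the curve is a solution in the zone `σ` -/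
def lcArc (F : Fin 3 → ℂ → ℂ) (z : ℝ → ℂ) (t τ : ℝ) (σ : Fin 3) : Prop :=
  0 < τ ∧ ∀ u ∈ Ioo t (t + τ), z u ∈ zonesLines σ ∧ HasDerivAt z (F σ (z u)) u

lemma lcArc_of {F : Fin 3 → ℂ → ℂ} {z φ : ℝ → ℂ} {t τ : ℝ} {σ : Fin 3} (hτ : 0 < τ)
    (h : ∀ s ∈ Icc 0 τ, z (t + s) = φ s)
    (hφ : ∀ s ∈ Ioo 0 τ, φ s ∈ zonesLines σ ∧ HasDerivAt φ (F σ (φ s)) s) :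
    lcArc F z t τ σ := by
  refine ⟨hτ, fun u hu => ?_⟩
  have hs : u - t ∈ Ioo 0 τ := ⟨by linarith [hu.1], by linarith [hu.2]⟩
  have e : z u = φ (u - t) := by
    rw [← h _ (Ioo_subset_Icc_self hs)]; congr 1; ring
  obtain ⟨h1, h2⟩ := hφ _ hs
  rw [e]
  refine ⟨h1, ?_⟩
  have h3 := h2.comp_sub_const u t
  refine h3.congr_of_eventuallyEq ?_
  filter_upwards [Ioo_mem_nhds hu.1 hu.2] with v hv
  rw [← h _ ⟨by linarith [hv.1], by linarith [hv.2]⟩]; congr 1; ring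

/-- local structure at time `u` -/
def lcR (F : Fin 3 → ℂ → ℂ) (z : ℝ → ℂ) (u : ℝ) : Prop :=
  (∃ σ, z u ∈ zonesLines σ ∧ HasDerivAt z (F σ (z u)) u) ∨
  (((z u).im = 1 ∨ (z u).im = -1) ∧ ∃ σ₁ σ₂ : Fin 3, σ₁ ≠ σ₂ ∧
    (∃ ε > 0, (∀ s ∈ Ioo (u - ε) u, z s ∈ zonesLines σ₁) ∧
      (∀ s ∈ Ioo u (u + ε), z s ∈ zonesLines σ₂)) ∧
    (F σ₁ (z u)).im ≠ 0 ∧ (F σ₂ (z u)).im ≠ 0 ∧ (0 < (F σ₁ (z u)).im ↔ 0 < (F σ₂ (z u)).im))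

lemma lcR_shift {F : Fin 3 → ℂ → ℂ} {z : ℝ → ℂ} {u p : ℝ} (hz : Function.Periodic z p)
    (h : lcR F z (u + p)) : lcR F z u := by
  unfold lcR at h
  rw [hz u] at h
  rcases h with ⟨σ, h1, h2⟩ | ⟨h1, σ₁, σ₂, hσ, ⟨ε, hε, hl, hr⟩, hn⟩
  · left
    refine ⟨σ, h1, ?_⟩
    have := h2.comp_add_const u p
    have e : (fun x => z (x + p)) = z := funext hz
    rwa [e] at this
  · right
    refine ⟨h1, σ₁, σ₂, hσ, ⟨ε, hε, fun s hs => ?_, fun s hs => ?_⟩, hn⟩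
    · rw [← hz s]; exact hl _ ⟨by linarith [hs.1], by linarith [hs.2]⟩
    · rw [← hz s]; exact hr _ ⟨by linarith [hs.1], by linarith [hs.2]⟩

lemma lcR_joint {F : Fin 3 → ℂ → ℂ} {z : ℝ → ℂ} {t τ τ' u : ℝ} {σ₁ σ₂ : Fin 3} (hu : t + τ = u)
    (h1 : lcArc F z t τ σ₁) (h2 : lcArc F z u τ' σ₂) (hσ : σ₁ ≠ σ₂) {x k : ℝ}
    (hk : k = 1 ∨ k = -1) (hz : z u = (x : ℂ) + (k : ℂ) * I)
    (hs : (0 < (F σ₁ ((x : ℂ) + (k : ℂ) * I)).im ∧ 0 < (F σ₂ ((x : ℂ) + (k : ℂ) * I)).im) ∨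
      ((F σ₁ ((x : ℂ) + (k : ℂ) * I)).im < 0 ∧ (F σ₂ ((x : ℂ) + (k : ℂ) * I)).im < 0)) :
    lcR F z u := by
  right
  rw [hz, lc_pt_im]
  have m1 := min_le_left τ τ'
  have m2 := min_le_right τ τ'
  refine ⟨hk, σ₁, σ₂, hσ, ⟨min τ τ', lt_min h1.1 h2.1, fun s hs => ?_, fun s hs => ?_⟩, ?_⟩
  · exact (h1.2 s ⟨by linarith [hs.1], by linarith [hs.2]⟩).1
  · exact (h2.2 s ⟨by linarith [hs.1], by linarith [hs.2]⟩).1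
  · rcases hs with ⟨a1, a2⟩ | ⟨a1, a2⟩
    · exact ⟨a1.ne', a2.ne', iff_of_true a1 a2⟩
    · exact ⟨a1.ne, a2.ne, iff_of_false a1.not_gt a2.not_gt⟩

lemma lcZ_unique {z : ℂ} {σ σ' : Fin 3} (h : z ∈ zonesLines σ) (h' : z ∈ zonesLines σ') :
    σ = σ' := by
  fin_cases σ <;> fin_cases σ' <;> first | rfl | (exfalso; revert h h'; simp only [Fin.zero_eta, Fin.mk_one, Fin.reduceFinMk, lcZ_zero, lcZ_one, lcZ_two, abs_lt]; intro h h'; (try obtain ⟨_, _⟩ := h); (try obtain ⟨_, _⟩ := h'); linarith)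

lemma lcZ_not_line {z : ℂ} {σ : Fin 3} (h : z ∈ zonesLines σ) : ¬ (z.im = 1 ∨ z.im = -1) := by
  rintro (e | e) <;> fin_cases σ <;> revert h <;> simp only [Fin.zero_eta, Fin.mk_one, Fin.reduceFinMk, lcZ_zero, lcZ_one, lcZ_two, e] <;> norm_num

lemma lc_orbit_of {F : Fin 3 → ℂ → ℂ} {z : ℝ → ℂ} {T : ℝ} (hT : 0 < T) (hc : Continuous z)
    (hp : Function.Periodic z T) (hne : ∃ s t, z s ≠ z t) (hR : ∀ u ∈ Ico 0 T, lcR F z u)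
    (hfin : {t ∈ Ico 0 T | (z t).im = 1 ∨ (z t).im = -1}.Finite) :
    IsCrossingPeriodicOrbit zonesLines F curvesLines z := by
  have hR' : ∀ u, lcR F z u := by
    intro u
    obtain ⟨n, hn, -⟩ := existsUnique_add_zsmul_mem_Ico hT u 0
    rw [zero_add] at hn
    exact lcR_shift (hp.zsmul n) (hR _ hn)
  refine ⟨T, hT, hc, hp, hne, ?_, ?_, ?_⟩
  · intro t σ hσ
    rcases hR' t with ⟨σ', h1, h2⟩ | ⟨h1, -⟩
    · rwa [lcZ_unique hσ h1]
    · exact absurd h1 (lcZ_not_line hσ)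
  · simpa only [lc_curves] using hfin
  · intro t ht
    rw [lc_curves] at ht
    rcases hR' t with ⟨σ', h1, h2⟩ | ⟨h1, σ₁, σ₂, hσ, hε, n1, n2, n3⟩
    · exact absurd ht (lcZ_not_line h1)
    · exact ⟨σ₁, σ₂, hσ, hε, lc_curves_normal _ _ _ n1 n2 n3⟩

lemma lcF0_im (a b c d x0 x1 x : ℝ) :
    (lcF a b c d x0 x1 0 ((x : ℂ) + ((1 : ℝ) : ℂ) * I)).im = b * (x + x1) := by
  rw [lcF_zero]; simp

lemma lcF2_im (a b c d x0 x1 x : ℝ) :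
    (lcF a b c d x0 x1 2 ((x : ℂ) + ((-1 : ℝ) : ℂ) * I)).im = d * (x - x0) := by
  rw [lcF_two]; simp

lemma lcF1_im (a b c d x0 x1 x k : ℝ) :
    (lcF a b c d x0 x1 1 ((x : ℂ) + (k : ℂ) * I)).im = x * (x ^ 2 - 3 * k ^ 2) := by
  rw [lcF_one]; simp only [lc_cube_im, lc_pt_im, lc_pt_re]

lemma lc_exists {a b c d x0 x1 X : ℝ} (hb : 0 < b) (hd : 0 < d)
    (hx0 : Real.sqrt 3 < x0) (hx1 : Real.sqrt 3 < x1)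
    (hX : lcP a b c d x0 x1 X = X) (hX3 : Real.sqrt 3 < X) :
    ∃ z : ℝ → ℂ, IsCrossingPeriodicOrbit zonesLines (lcF a b c d x0 x1) curvesLines z ∧
      Function.Periodic z (lcT a b d x1 X) ∧
      (∀ s ∈ Icc 0 (lcT a b d x1 X), z s = lcG a b c d x0 x1 X s) ∧ range z ⊆ lcU := by
  have hT : 0 < lcT a b d x1 X := lcT_pos hX3 hx1 hb hd
  have hy := lcY_neg (a := a) (b := b) hx1 hX3
  have hπ := Real.pi_pos
  have p1 : 0 < lcτ X := lcτ_pos hX3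
  have p2 : 0 < Real.pi / b := by positivity
  have p3 := lcτ_pos hy
  have p4 : 0 < Real.pi / d := by positivity
  have sX := lc_sq hX3
  have sY := lc_sq hy
  have s0 := (lc_sq hx0).2
  have s1 := (lc_sq hx1).2
  have hYx1 := lcY_lt (a := a) (b := b) hx1 hX3
  have hXx0 : x0 < X := by have := lcP_gt' (a := a) (b := b) (c := c) (d := d) hx0 hx1 hX3; rwa [hX] at this
  obtain ⟨z, hzc, hzp, hzG⟩ := lc_periodize hT (lcG_cont (c := c) (d := d) (x0 := x0) hX3 hx1 hb) (by
    rw [lcG_end hX3 hx1 hb hd, hX, lcG, lcCat_left p1.le, lcC_zero hX3])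
  have hTd : lcT a b d x1 X =
    lcτ X + (Real.pi / b + (lcτ (-(lcY a b x1 X)) + Real.pi / d)) := rfl
  have m3 := lc_m3 (c := c) (d := d) (x0 := x0) hy
  have m2 := lc_m2 (a := a) (b := b) (x1 := x1) (x := X) hb hy
  have m1 := lc_m1 (a := a) (b := b) (x1 := x1) hX3
  generalize hYdef : lcY a b x1 X = Y at *
  generalize hTT : lcT a b d x1 X = T at *
  generalize hτ1 : lcτ X = τ1 at *
  generalize hτ2 : Real.pi / b = τ2 at *
  generalize hτ3 : lcτ (-Y) = τ3 at *
  generalize hτ4 : Real.pi / d = τ4 at *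
  have f1 : ∀ s ∈ Icc 0 τ1, z (0 + s) = lcC X s := by
    intro s hs
    rw [zero_add, hzG s ⟨hs.1, by linarith [hs.2]⟩, lcG, hτ1, lcCat_left hs.2]
  have f2 : ∀ s ∈ Icc 0 τ2, z (τ1 + s) = lcL a b (-x1) X 1 s := by
    intro s hs
    rw [hzG _ ⟨by linarith [hs.1], by linarith [hs.2]⟩, lcG, hτ1, hYdef, hτ3, hτ2,
      lcCat_right (by rw [lcCat_left p2.le]; exact m1) hs.1, lcCat_left hs.2]
  have f3 : ∀ s ∈ Icc 0 τ3, z (τ1 + τ2 + s) = - lcC (-Y) s := by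
    intro s hs
    have := hs.1
    rw [hzG _ ⟨by linarith [hs.1], by linarith [hs.2]⟩, lcG, hτ1, hYdef, hτ3, hτ2, add_assoc,
      lcCat_right (by rw [lcCat_left p2.le]; exact m1) (by positivity),
      lcCat_right (by rw [lcCat_left p3.le]; exact m2) hs.1, lcCat_left hs.2]
  have f4 : ∀ s ∈ Icc 0 τ4, z (τ1 + τ2 + τ3 + s) = lcL c d x0 Y (-1) s := by
    intro s hs
    have := hs.1
    rw [hzG _ ⟨by linarith [hs.1], by linarith [hs.2]⟩, lcG, hτ1, hYdef, hτ3, hτ2, add_assoc,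
      add_assoc, lcCat_right (by rw [lcCat_left p2.le]; exact m1) (by positivity),
      lcCat_right (by rw [lcCat_left p3.le]; exact m2) (by positivity)]
    exact lcCat_right (φ := fun s => - lcC (-Y) s) (τ := τ3) m3 hs.1
  have f0 : ∀ s ∈ Icc 0 τ4, z (-τ4 + s) = lcL c d x0 Y (-1) s := by
    intro s hs
    rw [← f4 s hs, ← hzp]; congr 1; rw [hTd]; ring
  have arc4 : ∀ s ∈ Ioo 0 τ4, lcL c d x0 Y (-1) s ∈ zonesLines 2 ∧
      HasDerivAt (lcL c d x0 Y (-1)) (lcF a b c d x0 x1 2 (lcL c d x0 Y (-1) s)) s := by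
    intro s hs
    rw [← hτ4] at hs
    exact ⟨lc_arc4_mem hd (by linarith) hs, lc_arc4 a b c d x0 x1 Y s⟩
  have A0 : lcArc (lcF a b c d x0 x1) z (-τ4) τ4 2 := lcArc_of p4 f0 arc4
  have A4 : lcArc (lcF a b c d x0 x1) z (τ1 + τ2 + τ3) τ4 2 := lcArc_of p4 f4 arc4
  have A1 : lcArc (lcF a b c d x0 x1) z 0 τ1 1 := lcArc_of p1 f1 (by
    intro s hs
    rw [← hτ1] at hs
    exact ⟨lcC_strip hX3 hs, lcC_deriv hX3 s⟩)
  have A2 : lcArc (lcF a b c d x0 x1) z τ1 τ2 0 := lcArc_of p2 f2 (by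
    intro s hs
    rw [← hτ2] at hs
    exact ⟨lc_arc2_mem hb (by linarith) hs, lc_arc2 a b c d x0 x1 X s⟩)
  have A3 : lcArc (lcF a b c d x0 x1) z (τ1 + τ2) τ3 1 := lcArc_of p3 f3 (by
    intro s hs
    rw [← hτ3] at hs
    refine ⟨?_, lc_arc3 a b c d x0 x1 hy s⟩
    rw [lcZ_one, neg_im, abs_neg]
    exact lcC_strip hy hs)
  have e0 : z 0 = (X : ℂ) + ((-1 : ℝ) : ℂ) * I := by
    have := f1 0 ⟨le_rfl, p1.le⟩
    rwa [add_zero, lcC_zero hX3] at this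
  have e1 : z τ1 = (X : ℂ) + ((1 : ℝ) : ℂ) * I := by
    have := f2 0 ⟨le_rfl, p2.le⟩
    rwa [add_zero, lcL_zero] at this
  have e2 : z (τ1 + τ2) = (Y : ℂ) + ((1 : ℝ) : ℂ) * I := by
    have := f3 0 ⟨le_rfl, p3.le⟩
    rw [add_zero, lcC_zero hy] at this
    rw [this]; push_cast; ring
  have e3 : z (τ1 + τ2 + τ3) = (Y : ℂ) + ((-1 : ℝ) : ℂ) * I := by
    have := f4 0 ⟨le_rfl, p4.le⟩
    rwa [add_zero, lcL_zero] at this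
  have vX : 0 < X * (X ^ 2 - 3) := mul_pos sX.2 (by linarith)
  have vY : Y * (Y ^ 2 - 3) < 0 := mul_neg_of_neg_of_pos (by linarith) (by nlinarith)
  have J0 : lcR (lcF a b c d x0 x1) z 0 := by
    refine lcR_joint (by ring) A0 A1 (by decide) (Or.inr rfl) e0 (Or.inl ?_)
    rw [lcF2_im, lcF1_im]
    exact ⟨mul_pos hd (by linarith), by linarith⟩
  have J1 : lcR (lcF a b c d x0 x1) z τ1 := by
    refine lcR_joint (by ring) A1 A2 (by decide) (Or.inl rfl) e1 (Or.inl ?_)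
    rw [lcF0_im, lcF1_im]
    exact ⟨by linarith, mul_pos hb (by linarith)⟩
  have J2 : lcR (lcF a b c d x0 x1) z (τ1 + τ2) := by
    refine lcR_joint rfl A2 A3 (by decide) (Or.inl rfl) e2 (Or.inr ?_)
    rw [lcF0_im, lcF1_im]
    exact ⟨mul_neg_of_pos_of_neg hb (by linarith), by linarith⟩
  have J3 : lcR (lcF a b c d x0 x1) z (τ1 + τ2 + τ3) := by
    refine lcR_joint rfl A3 A4 (by decide) (Or.inr rfl) e3 (Or.inr ?_)
    rw [lcF2_im, lcF1_im]
    exact ⟨by linarith, mul_neg_of_pos_of_neg hd (by linarith)⟩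
  have classify : ∀ u ∈ Ico 0 T, u ∈ ({0, τ1, τ1 + τ2, τ1 + τ2 + τ3} : Set ℝ) ∨
      u ∈ Ioo 0 (0 + τ1) ∨ u ∈ Ioo τ1 (τ1 + τ2) ∨ u ∈ Ioo (τ1 + τ2) (τ1 + τ2 + τ3) ∨
      u ∈ Ioo (τ1 + τ2 + τ3) (τ1 + τ2 + τ3 + τ4) := by
    intro u hu
    obtain ⟨h0, h1⟩ := hu
    simp only [mem_insert_iff, mem_singleton_iff, mem_Ioo]
    grind
  have zoned : ∀ u ∈ Ico 0 T, u ∈ ({0, τ1, τ1 + τ2, τ1 + τ2 + τ3} : Set ℝ) ∨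
      ∃ σ, z u ∈ zonesLines σ ∧ HasDerivAt z (lcF a b c d x0 x1 σ (z u)) u := by
    intro u hu
    rcases classify u hu with h | h | h | h | h
    · exact Or.inl h
    · exact Or.inr ⟨_, A1.2 u h⟩
    · exact Or.inr ⟨_, A2.2 u h⟩
    · exact Or.inr ⟨_, A3.2 u h⟩
    · exact Or.inr ⟨_, A4.2 u h⟩
  have cone1 : ∀ u ∈ Icc 0 τ1, z u ∈ lcU := by
    intro u hu
    right
    have := f1 u hu
    rw [zero_add] at this
    rw [← hτ1] at hu
    rw [mem_ofPred_eq, this, abs_of_pos (lcC_re_pos hX3 u)]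
    exact lcC_cone hX3 hu
  have cone3 : ∀ s ∈ Icc 0 τ3, z (τ1 + τ2 + s) ∈ lcU := by
    intro u hu
    right
    have := f3 u hu
    rw [← hτ3] at hu
    rw [mem_ofPred_eq, this, neg_re, neg_im, abs_neg, abs_neg, abs_of_pos (lcC_re_pos hy u)]
    exact lcC_cone hy hu
  refine ⟨z, lc_orbit_of hT hzc hzp ⟨0, τ1, ?_⟩ ?_ ?_, hzp, hzG, ?_⟩
  · rw [e0, e1]
    intro h
    have := congrArg Complex.im h
    rw [lc_pt_im, lc_pt_im] at this
    norm_num at this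
  · intro u hu
    rcases zoned u hu with h | h
    · simp only [mem_insert_iff, mem_singleton_iff] at h
      rcases h with rfl | rfl | rfl | rfl
      · exact J0
      · exact J1
      · exact J2
      · exact J3
    · exact Or.inl h
  · refine Set.Finite.subset (s := ({0, τ1, τ1 + τ2, τ1 + τ2 + τ3} : Set ℝ)) (by simp) ?_
    rintro u ⟨hu, hl⟩
    rcases zoned u hu with h | ⟨σ, h, -⟩
    · exact h
    · exact absurd hl (lcZ_not_line h)
  · rintro _ ⟨u, rfl⟩
    obtain ⟨s, hs, hst⟩ := hzp.exists_mem_Ico₀ hT u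
    rw [hst]
    rcases classify s hs with h | h | h | h | h
    · simp only [mem_insert_iff, mem_singleton_iff] at h
      rcases h with rfl | rfl | rfl | rfl
      · exact cone1 _ ⟨le_rfl, p1.le⟩
      · exact cone1 _ ⟨p1.le, le_rfl⟩
      · simpa using cone3 0 ⟨le_rfl, p3.le⟩
      · exact cone3 _ ⟨p3.le, le_rfl⟩
    · exact cone1 _ ⟨h.1.le, by linarith [h.2]⟩
    · left
      have := (A2.2 s h).1
      rw [lcZ_zero] at this
      exact lt_of_lt_of_le this (le_abs_self _)
    · have := cone3 (s - (τ1 + τ2)) ⟨by linarith [h.1], by linarith [h.2]⟩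
      rwa [add_sub_cancel] at this
    · left
      have := (A4.2 s h).1
      rw [lcZ_two] at this
      exact lt_of_lt_of_le (show (1:ℝ) < -(z s).im by linarith) (neg_le_abs _)

lemma lc_fixed {a b c d x0 x1 : ℝ} (ha : a < 0) (hc : c < 0) (hb : 0 < b) (hd : 0 < d)
    (hx0 : Real.sqrt 3 < x0) (hx1 : Real.sqrt 3 < x1) :
    ∃ X, lcP a b c d x0 x1 X = X ∧ Real.sqrt 3 < X := by
  have r1 := lc_rate ha hb
  have r2 := lc_rate hc hd
  have q1 := Real.exp_pos (a * Real.pi / b)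
  have q2 := Real.exp_pos (c * Real.pi / d)
  have s0 := (lc_sq hx0).2
  have s1 := (lc_sq hx1).2
  unfold lcP lcY
  generalize Real.exp (a * Real.pi / b) = α at *
  generalize Real.exp (c * Real.pi / d) = β at *
  have hαβ : 0 < 1 - α * β := by nlinarith
  have hp : 0 < α * β := mul_pos q1 q2
  refine ⟨(x0 + x0 * β + x1 * β + x1 * α * β) / (1 - α * β), ?_, ?_⟩
  · have hXe := div_mul_cancel₀ (x0 + x0 * β + x1 * β + x1 * α * β) hαβ.ne'
    generalize (x0 + x0 * β + x1 * β + x1 * α * β) / (1 - α * β) = X at *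
    linear_combination -hXe
  · apply hx0.trans
    rw [lt_div_iff₀ hαβ]
    have : 0 < x0 * β + x1 * β + x1 * α * β + x0 * (α * β) := by positivity
    linarith
/-- **Proposition.** If `a, c < 0`, `b, d > 0`, `x₀, x₁ > √3`, then the system
`ż = (a+ib)(z - i + x₁)` in `Σ₊`, `ż = iz³` in `Σ_c`, `ż = (c+id)(z + i - x₀)` in `Σ₋`
has a crossing limit cycle. -/
theorem limit_cycle_cubic_center (a b c d x0 x1 : ℝ)
    (ha : a < 0) (hc : c < 0) (hb : 0 < b) (hd : 0 < d)
    (hx0 : Real.sqrt 3 < x0) (hx1 : Real.sqrt 3 < x1) :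
    ∃ z : ℝ → ℂ, IsCrossingLimitCycle zonesLines
      ![fun w => ((a : ℂ) + (b : ℂ) * Complex.I) * (w - Complex.I + (x1 : ℂ)),
        fun w => Complex.I * w ^ 3,
        fun w => ((c : ℂ) + (d : ℂ) * Complex.I) * (w + Complex.I - (x0 : ℂ))]
      curvesLines z := by
  obtain ⟨X, hX, hX3⟩ := lc_fixed ha hc hb hd hx0 hx1
  obtain ⟨z, hz, hzp, hzG, hzU⟩ := lc_exists (a := a) (b := b) (c := c) (d := d) hb hd hx0 hx1 hX hX3
  refine ⟨z, hz, lcU, lcU_open, hzU, fun w hw hwU => ?_⟩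
  obtain ⟨t, ht⟩ := lc_isol ha hc hb hd hx0 hx1 hw hwU hX
  exact lc_range_eq hb hd hx0 hx1 hw hX hX3 ht hzp hzG
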